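/- Let k be a field of characteristic p > 0, H₁ a finite group, H₂ a normal subgroup of H₁, and N a normal subgroup of H₂ of order prime to p; set H₃ = H₂/N. Fix n ≥ 0. Suppose there is a constant C such that dim Hᵐ(H₁, L') ≤ C for all irreducible kH₁-modules L' and all m ≤ n. Then there is a constant C', depending only on C, n, and the index [H₁ : H₂], such that dim Hⁿ(H₃, L) ≤ C' for every irreducible kH₃-module L. -/

import Mathlib

open CategoryTheory

section contract

variable {G Q : Type*} [Group G] [Group Q]

lemma injective_apply_contractNth {n : ℕ} (j : Fin (n + 1)) :
    Function.Injective fun g : Fin (n + 1) → G => (g j, Fin.contractNth j (· * ·) g) := by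
  intro g h hgh
  obtain ⟨hj, hc⟩ := Prod.ext_iff.1 hgh
  simp only at hj hc
  have key (i : Fin n) := congrFun hc i
  simp only [Fin.contractNth] at key
  funext i
  rcases lt_trichotomy i j with hij | rfl | hij
  · have hin : (i : ℕ) < n := by have := i.2; have := j.2; omega
    have := key ⟨i, hin⟩
    simpa [show (i : ℕ) < j from hij] using this
  · exact hj
  · obtain ⟨i, rfl⟩ : ∃ i' : Fin n, i = i'.succ :=
      ⟨i.pred (Fin.ne_zero_of_lt hij), by simp⟩
    have hle : (j : ℕ) ≤ i := by
      have : (j : ℕ) < i.succ := hij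
      simpa [Nat.lt_succ_iff] using this
    have hi := key i
    rw [if_neg hle.not_gt, if_neg hle.not_gt] at hi
    split_ifs at hi with h1
    · have : i.castSucc = j := Fin.ext h1
      rw [this, hj] at hi
      exact mul_left_cancel hi
    · exact hi

lemma injective_apply_tail {X : Type*} {n : ℕ} :
    Function.Injective fun g : Fin (n + 1) → X => (g 0, fun i : Fin n => g i.succ) := by
  intro g h hgh
  obtain ⟨h0, hs⟩ := Prod.ext_iff.1 hgh
  funext i
  exact Fin.cases h0 (fun i => congrFun hs i) i

open Classical in
lemma card_fiber [Fintype G] {f : G →* Q} (hf : Function.Surjective f) (q : Q) :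
    ({x | f x = q} : Finset G).card = Nat.card f.ker := by
  rw [← Set.ncard_coe_finset, ← Nat.card_coe_set_eq,
    Nat.card_congr (MonoidHom.fiberEquivKerOfSurjective hf q).symm]
  congr!
  ext
  simp

open Classical in
lemma sum_fiber_comp [Fintype G] {M : Type*} [AddCommMonoid M] {f : G →* Q}
    (hf : Function.Surjective f) {n : ℕ} (j : Fin (n + 1))
    {φ : (Fin (n + 1) → G) → Fin n → G} {ψ : (Fin (n + 1) → Q) → Fin n → Q}
    (hφ : Function.Injective fun g => (g j, φ g)) (hψ : Function.Injective fun q => (q j, ψ q))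
    (hφψ : ∀ g, f ∘ φ g = ψ (f ∘ g)) (F : (Fin n → G) → M) (q : Fin (n + 1) → Q) :
    ∑ g with f ∘ g = q, F (φ g) = Nat.card f.ker • ∑ g with f ∘ g = ψ q, F g := by
  have hbij := (Fintype.bijective_iff_injective_and_card _).2
    ⟨hφ, by simp [Fintype.card_prod, pow_succ']⟩
  calc ∑ g with f ∘ g = q, F (φ g)
      = ∑ p ∈ ({x | f x = q j} : Finset G) ×ˢ ({g | f ∘ g = ψ q} : Finset (Fin n → G)), F p.2 := by
        refine Finset.sum_bijective _ hbij (fun g => ?_) fun g _ => rfl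
        simp only [Finset.mem_filter, Finset.mem_univ, true_and, Finset.mem_product, hφψ]
        exact ⟨by rintro rfl; exact ⟨rfl, rfl⟩, fun h => hψ (Prod.ext h.1 h.2)⟩
    _ = _ := by rw [Finset.sum_product]; simp [card_fiber hf]

end contract

section inflation

open groupCohomology

universe u

variable {k G Q : Type u} [Field k] [Group G] [Group Q] [Finite G]

open Classical in
/-- Averaging cochains over the fibres of a surjective homomorphism `f : G →* Q`. -/
noncomputable def averageCochains (f : G →* Q) (A : Rep k Q) (n : ℕ) :
    ((Fin n → G) → A) →ₗ[k] ((Fin n → Q) → A) :=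
  letI := Fintype.ofFinite G
  { toFun := fun x q => ((Nat.card f.ker : k)⁻¹ ^ n) • ∑ g with f ∘ g = q, x g
    map_add' := fun x y => by
      funext q
      simp [Finset.sum_add_distrib]
    map_smul' := fun r x => by
      funext q
      simp [Finset.smul_sum, smul_comm r] }

lemma averageCochains_d {f : G →* Q} (hf : Function.Surjective f)
    (hk : (Nat.card f.ker : k) ≠ 0) (A : Rep k Q) (n : ℕ) (x : (Fin n → G) → A) :
    averageCochains f A (n + 1) ((inhomogeneousCochains.d (Rep.res f A) n).hom x) =
      (inhomogeneousCochains.d A n).hom (averageCochains f A n x) := by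
  classical
  let := Fintype.ofFinite G
  have hc (j : Fin (n + 1)) (q : Fin (n + 1) → Q) (F : (Fin n → G) → A) :=
    sum_fiber_comp hf j (injective_apply_contractNth j) (injective_apply_contractNth j)
      (Fin.comp_contractNth (f := f) _ _ (map_mul f) j) F q
  have ht (q : Fin (n + 1) → Q) (F : (Fin n → G) → A) :=
    sum_fiber_comp hf 0 injective_apply_tail injective_apply_tail
      (fun g => rfl) F q
  funext q
  simp only [averageCochains, LinearMap.coe_mk, AddHom.coe_mk]
  rw [inhomogeneousCochains.d_hom_apply]
  have h1 : ∑ g with f ∘ g = q, (inhomogeneousCochains.d (Rep.res f A) n).hom x g =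
      Nat.card f.ker • (A.ρ (q 0) (∑ g with f ∘ g = fun i => q i.succ, x g) +
        ∑ j : Fin (n + 1), (-1 : k) ^ ((j : ℕ) + 1) •
          ∑ g with f ∘ g = Fin.contractNth j (· * ·) q, x g) := by
    simp only [inhomogeneousCochains.d_hom_apply]
    rw [Finset.sum_add_distrib, Finset.sum_comm, smul_add, map_sum, ← ht, Finset.smul_sum]
    congr 1
    · refine Finset.sum_congr rfl fun g hg => ?_
      rw [← (Finset.mem_filter.1 hg).2]
      rfl
    · refine Finset.sum_congr rfl fun j _ => ?_
      rw [← Finset.smul_sum, smul_comm, ← hc]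
  rw [h1, ← Nat.cast_smul_eq_nsmul k, smul_smul, pow_succ, mul_assoc, inv_mul_cancel₀ hk, mul_one]
  rw [smul_add, map_smul, Finset.smul_sum]
  congr 1
  exact Finset.sum_congr rfl fun j _ => smul_comm _ _ _

lemma averageCochains_comp {f : G →* Q} (hf : Function.Surjective f)
    (hk : (Nat.card f.ker : k) ≠ 0) (A : Rep k Q) (n : ℕ) (x : (Fin n → Q) → A) :
    averageCochains f A n (fun g => x (f ∘ g)) = x := by
  classical
  let := Fintype.ofFinite G
  funext q
  simp only [averageCochains, LinearMap.coe_mk, AddHom.coe_mk]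
  have hcard : ({g | f ∘ g = q} : Finset (Fin n → G)).card = Nat.card f.ker ^ n := by
    have : ({g | f ∘ g = q} : Finset (Fin n → G)) =
        Fintype.piFinset fun i => ({x | f x = q i} : Finset G) := by
      ext; simp [funext_iff]
    rw [this, Fintype.card_piFinset]
    simp [card_fiber hf]
  rw [Finset.sum_congr rfl (g := fun _ => x q)
    fun g hg => congrArg x (Finset.mem_filter.1 hg).2]
  rw [Finset.sum_const, hcard, ← Nat.cast_smul_eq_nsmul k, smul_smul, Nat.cast_pow, ← mul_pow,
    inv_mul_cancel₀ hk, one_pow, one_smul]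

/-- Averaging as a morphism of cochain complexes. -/
noncomputable def averageCochainsMap {f : G →* Q} (hf : Function.Surjective f)
    (hk : (Nat.card f.ker : k) ≠ 0) (A : Rep k Q) :
    inhomogeneousCochains (Rep.res f A) ⟶ inhomogeneousCochains A where
  f n := ModuleCat.ofHom (averageCochains f A n)
  comm' i j (hij : _ = _) := by
    subst hij
    rw [inhomogeneousCochains.d_def, inhomogeneousCochains.d_def]
    ext x : 2
    exact (averageCochains_d hf hk A i x).symm

lemma cochainsMap_comp_averageCochainsMap {f : G →* Q} (hf : Function.Surjective f)
    (hk : (Nat.card f.ker : k) ≠ 0) (A : Rep k Q) :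
    cochainsMap f (𝟙 (Rep.res f A)) ≫ averageCochainsMap hf hk A = 𝟙 _ := by
  ext n x : 3
  exact averageCochains_comp hf hk A n x

/-- Inflation along a surjection whose kernel has order invertible in `k` is injective on cohomology. -/
lemma mono_inflation {f : G →* Q} (hf : Function.Surjective f)
    (hk : (Nat.card f.ker : k) ≠ 0) (A : Rep k Q) (n : ℕ) :
    Mono (groupCohomology.map f (𝟙 (Rep.res f A)) n) := by
  have h := congrArg (fun φ => HomologicalComplex.homologyMap φ n)
    (cochainsMap_comp_averageCochainsMap hf hk A)
  simp only [HomologicalComplex.homologyMap_comp, HomologicalComplex.homologyMap_id] at h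
  exact (SplitMono.mk _ h : SplitMono (groupCohomology.map f (𝟙 (Rep.res f A)) n)).mono

lemma finite_groupCohomology (A : Rep k G) [Module.Finite k A] (n : ℕ) :
    Module.Finite k (groupCohomology A n) := by
  have h1 : Module.Finite k (cocycles A n) := by
    have : Module.Finite k ((inhomogeneousCochains A).X n) :=
      inferInstanceAs (Module.Finite k ((Fin n → G) → A))
    exact Module.Finite.of_injective (iCocycles A n).hom
      ((ModuleCat.mono_iff_injective _).1 inferInstance)
  exact Module.Finite.of_surjective (groupCohomology.π A n).hom
    ((ModuleCat.epi_iff_surjective _).1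
      (inferInstanceAs (Epi ((inhomogeneousCochains A).homologyπ n))))

lemma subsingleton_groupCohomology {Γ : Type u} [Group Γ] (A : Rep k Γ) [Subsingleton A] (n : ℕ) :
    Subsingleton (groupCohomology A n) := by
  have : Subsingleton ((inhomogeneousCochains A).X n) :=
    inferInstanceAs (Subsingleton ((Fin n → Γ) → A))
  have : Subsingleton (cocycles A n) :=
    ((ModuleCat.mono_iff_injective (iCocycles A n)).1 inferInstance).subsingleton
  exact ((ModuleCat.epi_iff_surjective (groupCohomology.π A n)).1
    (inferInstanceAs (Epi ((inhomogeneousCochains A).homologyπ n)))).subsingleton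

lemma finrank_groupCohomology_le_of_surjective {f : G →* Q} (hf : Function.Surjective f)
    (hk : (Nat.card f.ker : k) ≠ 0) (A : Rep k Q) [Module.Finite k A] (n : ℕ) :
    Module.finrank k (groupCohomology A n) ≤
      Module.finrank k (groupCohomology (Rep.res f A) n) := by
  have : Module.Finite k (Rep.res f A) := inferInstanceAs (Module.Finite k A)
  have := finite_groupCohomology (Rep.res f A) n
  exact LinearMap.finrank_le_finrank_of_injective
    ((ModuleCat.mono_iff_injective _).1 (mono_inflation hf hk A n))

lemma finrank_le_add_of_range_eq_ker {M₁ M₂ M₃ : Type*} [AddCommGroup M₁] [AddCommGroup M₂]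
    [AddCommGroup M₃] [Module k M₁] [Module k M₂] [Module k M₃] [Module.Finite k M₁]
    [Module.Finite k M₃] (f : M₁ →ₗ[k] M₂) (g : M₂ →ₗ[k] M₃)
    (h : LinearMap.range f = LinearMap.ker g) :
    Module.finrank k M₂ ≤ Module.finrank k M₁ + Module.finrank k M₃ := by
  by_cases hM : Module.Finite k M₂
  · rw [← LinearMap.finrank_range_add_finrank_ker g, ← h, add_comm]
    exact add_le_add (LinearMap.finrank_range_le f) (Submodule.finrank_le _)
  · simp [Module.finrank_of_not_finite hM]

lemma finrank_groupCohomology_le_add {X : ShortComplex (Rep k G)} (hX : X.ShortExact)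
    [Module.Finite k X.X₁] [Module.Finite k X.X₃] (n : ℕ) :
    Module.finrank k (groupCohomology X.X₂ n) ≤
      Module.finrank k (groupCohomology X.X₁ n) + Module.finrank k (groupCohomology X.X₃ n) := by
  have := finite_groupCohomology X.X₁ n
  have := finite_groupCohomology X.X₃ n
  have hex := mapShortComplex₂_exact hX n
  rw [ShortComplex.moduleCat_exact_iff_range_eq_ker] at hex
  have : Module.Finite k (groupCohomology.mapShortComplex₂ X n).X₁ := ‹_›
  have : Module.Finite k (groupCohomology.mapShortComplex₂ X n).X₃ := ‹_›
  exact finrank_le_add_of_range_eq_ker _ _ hex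

end inflation

section length

open scoped MonoidAlgebra

namespace Representation

variable {k G H V W : Type*} [Field k] [Group G] [Group H] [AddCommGroup V] [Module k V]
  [AddCommGroup W] [Module k W]

/-- The length of a representation, as a module over the group algebra. -/
noncomputable def length (ρ : Representation k G V) : ℕ∞ :=
  Module.length k[G] ρ.asModule

lemma coe_length (ρ : Representation k G V) :
    (ρ.length : WithBot ℕ∞) = Order.krullDim (Subrepresentation ρ) := by
  rw [length, Module.coe_length]
  exact (Order.krullDim_eq_of_orderIso Subrepresentation.subrepresentationSubmoduleOrderIso).symm

lemma length_le_length_comp (ρ : Representation k G V) (f : H →* G) :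
    ρ.length ≤ (Representation.length (ρ.comp f)) := by
  rw [← WithBot.coe_le_coe, coe_length, coe_length]
  exact Order.krullDim_le_of_strictMono
    (fun U => (⟨U.toSubmodule, fun h _ hv => U.apply_mem_toSubmodule (f h) hv⟩ :
      Subrepresentation (ρ.comp f))) fun _ _ h => h

lemma length_comp_le_of_surjective (ρ : Representation k G V) {f : H →* G}
    (hf : Function.Surjective f) : Representation.length (ρ.comp f) ≤ ρ.length := by
  rw [← WithBot.coe_le_coe, coe_length, coe_length]
  refine Order.krullDim_le_of_strictMono
    (fun U : Subrepresentation (ρ.comp f) => (⟨U.toSubmodule, fun g v hv => ?_⟩ :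
      Subrepresentation ρ)) fun _ _ h => h
  obtain ⟨h, rfl⟩ := hf g
  exact U.apply_mem_toSubmodule h hv

lemma length_eq_add {U : Type*} [AddCommGroup U] [Module k U] {ρ : Representation k G V}
    {σ : Representation k G W} {τ : Representation k G U} (f : ρ.IntertwiningMap σ)
    (g : σ.IntertwiningMap τ) (hf : Function.Injective f) (hg : Function.Surjective g)
    (hfg : Function.Exact f g) : σ.length = ρ.length + τ.length :=
  Module.length_eq_add_of_exact (IntertwiningMap.equivLinearMapAsModule ρ σ f)
    (IntertwiningMap.equivLinearMapAsModule σ τ g) hf hg hfg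

lemma length_le_sum {ι : Type*} [Fintype ι] {U : ι → Type*} [∀ i, AddCommGroup (U i)]
    [∀ i, Module k (U i)] {ρ : Representation k G V} (σ : ∀ i, Representation k G (U i))
    (f : ∀ i, ρ.IntertwiningMap (σ i)) (hf : ∀ v, (∀ i, f i v = 0) → v = 0) :
    ρ.length ≤ ∑ i, (σ i).length := by
  have := Module.length_le_of_injective
    (LinearMap.pi fun i => IntertwiningMap.equivLinearMapAsModule ρ (σ i) (f i))
    ((injective_iff_map_eq_zero _).2 fun v hv => hf v fun i => congrFun hv i)
  rwa [Module.length_pi_of_fintype] at this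

end Representation

namespace Rep

universe u

variable {k G : Type u} [Field k] [Group G]

lemma simple_iff_length_eq_one (V : Rep.{u} k G) : Simple V ↔ V.ρ.length = 1 := by
  rw [← simple_obj_iff toModuleMonoidAlgebra, Representation.length, Module.length_eq_one_iff]
  exact simple_iff_isSimpleModule

lemma finite_of_simple [Finite G] (V : Rep.{u} k G) [Simple V] : Module.Finite k V := by
  obtain ⟨v, hv⟩ : ∃ v : V, v ≠ 0 := by
    by_contra! h
    exact Simple.not_isZero V ((isZero_iff (k := k) (G := G) V).2 (subsingleton_of_forall_eq 0 h))
  have hs := (simple_iff_length_eq_one V).1 ‹_›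
  rw [Representation.length, Module.length_eq_one_iff,
    ← Representation.irreducible_iff_isSimpleModule_asModule] at hs
  let U : Subrepresentation V.ρ :=
    ⟨Submodule.span k (Set.range fun g => V.ρ g v), fun g w hw => by
      induction hw using Submodule.span_induction with
      | mem w hw =>
        obtain ⟨h, rfl⟩ := hw
        refine Submodule.subset_span ⟨g * h, ?_⟩
        simp
      | zero => simp
      | add a b _ _ ha hb => rw [map_add]; exact add_mem ha hb
      | smul r a _ ha => rw [map_smul]; exact Submodule.smul_mem _ r ha⟩
  have hvU : v ∈ U.toSubmodule := Submodule.subset_span ⟨1, by simp⟩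
  rcases eq_bot_or_eq_top U with hU | hU
  · rw [hU] at hvU
    exact absurd hvU hv
  · have : U.toSubmodule = ⊤ := by rw [hU]; rfl
    refine ⟨?_⟩
    rw [← this]
    exact Submodule.fg_span (Set.finite_range _)

lemma shortExact_subtype_mkQ (V : Rep.{u} k G) (W : Submodule k V)
    (hW : ∀ g, W ≤ W.comap (V.ρ g)) :
    (ShortComplex.mk (V.subtype W hW) (V.mkQ W hW) (by
      ext x
      exact (Submodule.Quotient.mk_eq_zero W).2 x.2)).ShortExact where
  exact := by
    rw [← ShortComplex.exact_map_iff_of_faithful _ (forget₂ (Rep k G) (ModuleCat k)),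
      ShortComplex.moduleCat_exact_iff]
    intro x hx
    exact ⟨⟨x, (Submodule.Quotient.mk_eq_zero W).1 hx⟩, rfl⟩
  mono_f := (mono_iff_injective _).2 Subtype.val_injective
  epi_g := (epi_iff_surjective _).2 (Submodule.mkQ_surjective W)

/-- A bound on the cohomology of simple representations bounds the cohomology of a
finite-dimensional representation by its length. -/
lemma finrank_groupCohomology_le_length_mul [Finite G] {n C : ℕ}
    (hC : ∀ L : Rep.{u} k G, Simple L → Module.finrank k (groupCohomology L n) ≤ C)
    (V : Rep.{u} k G) [Module.Finite k V] :
    (Module.finrank k (groupCohomology V n) : ℕ∞) ≤ V.ρ.length * C := by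
  induction hd : Module.finrank k V using Nat.strong_induction_on generalizing V with
  | _ d ih =>
  subst hd
  by_cases hV : IsSimpleOrder (Subrepresentation V.ρ)
  · have h1 : V.ρ.length = 1 := by
      rw [Representation.length, Module.length_eq_one_iff,
        ← Representation.irreducible_iff_isSimpleModule_asModule]
      exact hV
    rw [h1, one_mul]
    exact_mod_cast hC V ((simple_iff_length_eq_one V).2 h1)
  by_cases h0 : Subsingleton V
  · have := subsingleton_groupCohomology V n
    rw [Module.finrank_zero_of_subsingleton]
    simp
  obtain ⟨U, hU0, hU1⟩ : ∃ U : Subrepresentation V.ρ, U ≠ ⊥ ∧ U ≠ ⊤ := by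
    by_contra! h
    have : Nontrivial (Subrepresentation V.ρ) := ⟨⊥, ⊤, fun h => h0 ?_⟩
    · exact hV ⟨fun U => or_iff_not_imp_left.2 (h U)⟩
    · have h' : (⊥ : Submodule k V) = ⊤ := congrArg Subrepresentation.toSubmodule h
      exact (Submodule.subsingleton_iff k).1 (subsingleton_of_bot_eq_top h')
  have hU : ∀ g, U.toSubmodule ≤ U.toSubmodule.comap (V.ρ g) :=
    fun g _ hv => U.apply_mem_toSubmodule g hv
  have hU0' : U.toSubmodule ≠ ⊥ := fun h => hU0 (Subrepresentation.toSubmodule_injective h)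
  have hU1' : U.toSubmodule ≠ ⊤ := fun h => hU1 (Subrepresentation.toSubmodule_injective h)
  have hX := shortExact_subtype_mkQ V U.toSubmodule hU
  have f1 : Module.Finite k (V.subrepresentation U.toSubmodule hU) :=
    inferInstanceAs (Module.Finite k U.toSubmodule)
  have f2 : Module.Finite k (V.quotient U.toSubmodule hU) :=
    inferInstanceAs (Module.Finite k (V ⧸ U.toSubmodule))
  have i1 := ih _ (Submodule.finrank_lt hU1') (V.subrepresentation U.toSubmodule hU) rfl
  have i2 := ih _ (by
    have : Module.finrank k (V.quotient U.toSubmodule hU) + Module.finrank k U.toSubmodule =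
        Module.finrank k V := Submodule.finrank_quotient_add_finrank U.toSubmodule
    have := Submodule.one_le_finrank_iff.2 hU0'
    omega) (V.quotient U.toSubmodule hU) rfl
  have hlen := Representation.length_eq_add (V.subtype U.toSubmodule hU).hom
    (V.mkQ U.toSubmodule hU).hom Subtype.val_injective (Submodule.mkQ_surjective _)
    (fun x => by
      refine (Submodule.Quotient.mk_eq_zero U.toSubmodule).trans ?_
      exact ⟨fun h => ⟨⟨x, h⟩, rfl⟩, fun ⟨y, hy⟩ => hy ▸ y.2⟩)
  calc (Module.finrank k (groupCohomology V n) : ℕ∞)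
      ≤ ((Module.finrank k (groupCohomology (V.subrepresentation U.toSubmodule hU) n) +
          Module.finrank k (groupCohomology (V.quotient U.toSubmodule hU) n) : ℕ) : ℕ∞) := by
        exact_mod_cast finrank_groupCohomology_le_add hX n
    _ ≤ _ := by
        rw [hlen, add_mul]
        push_cast
        exact add_le_add i1 i2

end Rep

end length

section descent

universe u

variable {k G : Type u} [Field k] [Group G]

/-- Evaluation of a coinduced function at `g`, as a map from the restriction of the coinduced
representation to the conjugate representation. -/
def coindEval (H : Subgroup G) [H.Normal] (A : Rep.{u} k H) (g : G) :
    Representation.IntertwiningMap ((Rep.coind H.subtype A).ρ.comp H.subtype)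
      (A.ρ.comp (MulAut.conjNormal g : MulAut H).toMonoidHom) where
  toLinearMap := (LinearMap.proj g).comp (Representation.coindV H.subtype A.ρ).subtype
  isIntertwining' h := by
    ext f
    refine Eq.trans ?_ (f.2 (MulAut.conjNormal g h) g)
    change f.1 (g * h) = f.1 (MulAut.conjNormal g h * g)
    simp [MulAut.conjNormal_apply]

/-- By Clifford's argument, coinduction from a normal subgroup multiplies the length by at most
the index. -/
lemma length_coind_le (H : Subgroup G) [H.Normal] [Finite G] (A : Rep.{u} k H) :
    (Rep.coind H.subtype A).ρ.length ≤ H.index * A.ρ.length := by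
  have := Fintype.ofFinite (G ⧸ H)
  refine (Representation.length_le_length_comp _ H.subtype).trans ?_
  refine (Representation.length_le_sum (ι := G ⧸ H) _
    (fun i => coindEval H A i.out) fun f hf => ?_).trans ?_
  · refine Subtype.ext (funext fun g => ?_)
    have hmem : g * ((g : G ⧸ H).out)⁻¹ ∈ H := by
      rw [← Subgroup.Normal.mem_comm_iff ‹_›, ← QuotientGroup.eq]
      simp
    have h1 := f.2 ⟨_, hmem⟩ (g : G ⧸ H).out
    have h2 : f.1 (g : G ⧸ H).out = 0 := hf (g : G ⧸ H)
    rw [h2] at h1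
    simpa using h1
  · refine (Finset.sum_le_card_nsmul _ _ A.ρ.length fun i _ =>
      Representation.length_comp_le_of_surjective _ (MulEquiv.surjective _)).trans ?_
    simp [Subgroup.index, Nat.card_eq_fintype_card]

lemma finrank_groupCohomology_le_index_mul [Finite G] {n C : ℕ}
    (hC : ∀ L : Rep.{u} k G, Simple L → Module.finrank k (groupCohomology L n) ≤ C)
    (H : Subgroup G) [H.Normal] (A : Rep.{u} k H) [Module.Finite k A] (hA : A.ρ.length ≤ 1) :
    Module.finrank k (groupCohomology A n) ≤ H.index * C := by
  have : Module.Finite k (Rep.coind H.subtype A) :=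
    inferInstanceAs (Module.Finite k (Representation.coindV H.subtype A.ρ))
  have h := Rep.finrank_groupCohomology_le_length_mul hC (Rep.coind H.subtype A)
  rw [← (groupCohomology.coindIso A n).toLinearEquiv.finrank_eq]
  have h' := (length_coind_le H A).trans (mul_le_mul_right hA _)
  rw [mul_one] at h'
  exact_mod_cast h.trans (mul_le_mul_left h' _)

end descent

/-- Let `k` have characteristic `p > 0`, `H₁` a finite group, `H₂ ⊴ H₁`, and `N ⊴ H₂`
of order prime to `p`; set `H₃ = H₂/N`.  If `dim Hᵐ(H₁, L') ≤ C` for all irreducible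
`kH₁`-modules `L'` and all `m ≤ n`, then `dim Hⁿ(H₃, L) ≤ C'` for all irreducible
`kH₃`-modules `L`, where `C'` depends only on `C`, `n` and the index `[H₁ : H₂]`. -/
theorem cohomology_bound_descends_to_sections
    (p : ℕ) (hp : p.Prime) :
    ∃ C' : ℕ → ℕ → ℕ → ℕ,
      ∀ (k : Type) [Field k] [CharP k p]
        (H₁ : Type) [Group H₁] [Finite H₁]
        (H₂ : Subgroup H₁) [H₂.Normal]
        (N : Subgroup H₂) [N.Normal],
        Nat.Coprime (Nat.card N) p →
        ∀ n C : ℕ,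
          (∀ m ≤ n, ∀ L' : Rep k H₁, Simple L' →
            Module.finrank k (groupCohomology L' m) ≤ C) →
          ∀ L : Rep k (H₂ ⧸ N), Simple L →
            Module.finrank k (groupCohomology L n) ≤ C' C n H₂.index := by
  refine ⟨fun C _ i => i * C, fun k _ _ H₁ _ _ H₂ _ N _ hN n C hC L hL => ?_⟩
  have hk : (Nat.card (QuotientGroup.mk' N).ker : k) ≠ 0 := by
    rw [QuotientGroup.ker_mk', Ne, CharP.cast_eq_zero_iff k p]
    exact (hp.coprime_iff_not_dvd).1 hN.symm
  have hfin := Rep.finite_of_simple L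
  have hfin' : Module.Finite k (Rep.res (QuotientGroup.mk' N) L) := hfin
  refine (finrank_groupCohomology_le_of_surjective (QuotientGroup.mk'_surjective N) hk L n).trans ?_
  refine finrank_groupCohomology_le_index_mul (hC n le_rfl) H₂ _ ?_
  exact (Representation.length_comp_le_of_surjective L.ρ (QuotientGroup.mk'_surjective N)).trans
    ((Rep.simple_iff_length_eq_one L).1 hL).le
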